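/- Let K be a field of characteristic zero and let v_0, …, v_9 be nonzero vectors in K^4. Assume [v_0 v_1 v_2 v_3] ≠ 0, [v_0 v_1 v_4 v_5] ≠ 0, [v_2 v_3 v_4 v_5] ≠ 0 (the lines 01, 23, 45 are mutually skew) and that the bracket binomial [v_0 v_1 v_2 v_5][v_0 v_2 v_3 v_4][v_1 v_3 v_4 v_5] − [v_0 v_1 v_2 v_4][v_2 v_3 v_4 v_5][v_0 v_1 v_3 v_5] is nonzero. Let M be the 4×4 matrix whose row indexed by the point k ∈ {6,7,8,9} is ([v_0 v_1 v_5 v_k][v_2 v_3 v_4 v_k], [v_0 v_1 v_2 v_k][v_3 v_4 v_5 v_k], [v_0 v_2 v_4 v_k][v_1 v_3 v_5 v_k], [v_0 v_4 v_5 v_k][v_1 v_2 v_3 v_k]). Then there exists a nonzero homogeneous polynomial of degree 2 in 4 variables over K vanishing at all ten vectors v_0, …, v_9 if and only if det(M) = 0. -/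

import Mathlib

/-- The bracket `[a b c d]`: determinant of the 4×4 matrix with columns
(equivalently rows) `a`, `b`, `c`, `d`. -/
def br {K : Type*} [CommRing K] (a b c d : Fin 4 → K) : K :=
  (Matrix.of ![a, b, c, d]).det

section ReducibleQuadrics

open Matrix

variable {K : Type*}

/-- The bracket, expanded as a polynomial in the coordinates. -/
theorem br_eq [CommRing K] (a b c d : Fin 4 → K) :
    br a b c d =
      a 0 * (b 1 * (c 2 * d 3 - c 3 * d 2) - b 2 * (c 1 * d 3 - c 3 * d 1)
        + b 3 * (c 1 * d 2 - c 2 * d 1))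
      - a 1 * (b 0 * (c 2 * d 3 - c 3 * d 2) - b 2 * (c 0 * d 3 - c 3 * d 0)
        + b 3 * (c 0 * d 2 - c 2 * d 0))
      + a 2 * (b 0 * (c 1 * d 3 - c 3 * d 1) - b 1 * (c 0 * d 3 - c 3 * d 0)
        + b 3 * (c 0 * d 1 - c 1 * d 0))
      - a 3 * (b 0 * (c 1 * d 2 - c 2 * d 1) - b 1 * (c 0 * d 2 - c 2 * d 0)
        + b 2 * (c 0 * d 1 - c 1 * d 0)) := by
  simp [br, Matrix.det_succ_row_zero, Fin.sum_univ_succ, Fin.succAbove]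
  ring

/-- Brackets are relative invariants of linear changes of coordinates. -/
theorem br_vecMul [CommRing K] (P : Matrix (Fin 4) (Fin 4) K) (a b c d : Fin 4 → K) :
    br (a ᵥ* P) (b ᵥ* P) (c ᵥ* P) (d ᵥ* P) = br a b c d * P.det := by
  rw [br, br, ← Matrix.det_mul]
  congr 1
  ext i j
  fin_cases i <;> rfl

/-- The values at `x` of the four reducible quadrics through the six points `p`. -/
def reducibleQuadrics [CommRing K] (p : Fin 6 → Fin 4 → K) (x : Fin 4 → K) : Fin 4 → K :=
  ![br (p 0) (p 1) (p 5) x * br (p 2) (p 3) (p 4) x,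
    br (p 0) (p 1) (p 2) x * br (p 3) (p 4) (p 5) x,
    br (p 0) (p 2) (p 4) x * br (p 1) (p 3) (p 5) x,
    br (p 0) (p 4) (p 5) x * br (p 1) (p 2) (p 3) x]

/-- The bracket binomial of six points. -/
def bracketBinomial [CommRing K] (p : Fin 6 → Fin 4 → K) : K :=
  br (p 0) (p 1) (p 2) (p 5) * br (p 0) (p 2) (p 3) (p 4) * br (p 1) (p 3) (p 4) (p 5) -
    br (p 0) (p 1) (p 2) (p 4) * br (p 2) (p 3) (p 4) (p 5) * br (p 0) (p 1) (p 3) (p 5)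

theorem reducibleQuadrics_vecMul [CommRing K] (P : Matrix (Fin 4) (Fin 4) K)
    (p : Fin 6 → Fin 4 → K) (x : Fin 4 → K) :
    reducibleQuadrics (fun i => p i ᵥ* P) (x ᵥ* P) = P.det ^ 2 • reducibleQuadrics p x := by
  ext j
  fin_cases j <;> simp [reducibleQuadrics, br_vecMul] <;> ring

theorem bracketBinomial_vecMul [CommRing K] (P : Matrix (Fin 4) (Fin 4) K)
    (p : Fin 6 → Fin 4 → K) :
    bracketBinomial (fun i => p i ᵥ* P) = P.det ^ 3 * bracketBinomial p := by
  simp only [bracketBinomial, br_vecMul]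
  ring

theorem reducibleQuadrics_self [CommRing K] (p : Fin 6 → Fin 4 → K) (i : Fin 6) :
    reducibleQuadrics p (p i) = 0 := by
  ext j
  fin_cases i <;> fin_cases j <;> simp [reducibleQuadrics, br_eq] <;> ring

/-- The functions on `K ^ 4` given by quadratic forms. -/
def quadraticFunctions (K : Type*) [CommRing K] : Submodule K ((Fin 4 → K) → K) where
  carrier := {g | ∃ s : Matrix (Fin 4) (Fin 4) K, ∀ x, g x = x ⬝ᵥ s *ᵥ x}
  zero_mem' := ⟨0, by simp⟩
  add_mem' := by
    rintro _ _ ⟨s, hs⟩ ⟨t, ht⟩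
    exact ⟨s + t, fun x => by simp [hs, ht, add_mulVec]⟩
  smul_mem' := by
    rintro c _ ⟨s, hs⟩
    exact ⟨c • s, fun x => by simp [hs, smul_mulVec]⟩

theorem br_eq_dotProduct [CommRing K] (a b c x : Fin 4 → K) :
    br a b c x = (fun i => br a b c (Pi.single i 1)) ⬝ᵥ x := by
  simp [br_eq, dotProduct, Fin.sum_univ_four]
  ring

theorem mul_br_mem_quadraticFunctions [CommRing K] (a b c a' b' c' : Fin 4 → K) :
    (fun x => br a b c x * br a' b' c' x) ∈ quadraticFunctions K := by
  refine ⟨vecMulVec (fun i => br a b c (Pi.single i 1)) (fun i => br a' b' c' (Pi.single i 1)),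
    fun x => ?_⟩
  simp only [br_eq_dotProduct a b c x, br_eq_dotProduct a' b' c' x]
  simp [vecMulVec_mulVec, dotProduct_comm, mul_comm]

theorem sum_reducibleQuadrics_mem_quadraticFunctions [CommRing K] (p : Fin 6 → Fin 4 → K)
    (w : Fin 4 → K) : (fun x => reducibleQuadrics p x ⬝ᵥ w) ∈ quadraticFunctions K := by
  have h : (fun x => reducibleQuadrics p x ⬝ᵥ w) =
      ∑ j, w j • fun x => reducibleQuadrics p x j := by
    ext x
    simp [dotProduct, mul_comm]
  rw [h]
  refine Submodule.sum_mem _ fun j _ => Submodule.smul_mem _ _ ?_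
  fin_cases j <;> exact mul_br_mem_quadraticFunctions _ _ _ _ _ _

theorem comp_vecMul_mem_quadraticFunctions [CommRing K] {g : (Fin 4 → K) → K}
    (hg : g ∈ quadraticFunctions K) (P : Matrix (Fin 4) (Fin 4) K) :
    (fun x => g (x ᵥ* P)) ∈ quadraticFunctions K := by
  obtain ⟨s, hs⟩ := hg
  refine ⟨P * s * Pᵀ, fun x => ?_⟩
  simp only [hs]
  rw [← dotProduct_mulVec, ← mulVec_transpose, mulVec_mulVec, mulVec_mulVec,
    Matrix.mul_assoc]

theorem MvPolynomial.IsHomogeneous.eval_mem_quadraticFunctions [CommRing K]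
    {f : MvPolynomial (Fin 4) K} (hf : f.IsHomogeneous 2) :
    (fun x => MvPolynomial.eval x f) ∈ quadraticFunctions K := by
  have h : (fun x => MvPolynomial.eval x f) =
      ∑ d ∈ f.support, f.coeff d • fun x : Fin 4 → K => ∏ i, x i ^ d i := by
    ext x
    simp [MvPolynomial.eval_eq']
  rw [h]
  refine Submodule.sum_mem _ fun d hd => Submodule.smul_mem _ _ ?_
  have hdeg : d.degree = 2 := by
    by_contra hne
    exact MvPolynomial.mem_support_iff.mp hd (hf.coeff_eq_zero hne)
  obtain ⟨i, j, hij⟩ := Multiset.card_eq_two.mp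
    (show Multiset.card (Finsupp.toMultiset d) = 2 by
      rw [Finsupp.card_toMultiset, ← hdeg]; rfl)
  refine ⟨Matrix.single i j 1, fun x => ?_⟩
  have hprod : ∏ i, x i ^ d i = ((Finsupp.toMultiset d).map x).prod := by
    rw [Finsupp.toMultiset_map, Finsupp.prod_toMultiset, Finsupp.prod_mapDomain_index,
      Finsupp.prod_fintype] <;> simp [pow_add]
  simp only [hprod, hij]
  simp only [Multiset.insert_eq_cons, Multiset.map_cons, Multiset.map_singleton,
    Multiset.prod_cons, Multiset.prod_singleton, single_mulVec, one_mul]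
  exact (dotProduct_single x (x j) i).symm

/-- The standard basis together with two more points. -/
def frame [CommRing K] (a b : Fin 4 → K) : Fin 6 → Fin 4 → K :=
  ![Pi.single 0 1, Pi.single 1 1, Pi.single 2 1, Pi.single 3 1, a, b]

/-- Points on the three lines spanned by pairs in `frame a b`, and one point off them. -/
def complementaryPoints [CommRing K] (a b : Fin 4 → K) : Fin 4 → Fin 4 → K :=
  ![![1, 1, 0, 0], ![0, 0, 1, 1], a + b, ![a 0, a 1, b 2, b 3]]

/-- The ten points of `frame` and `complementaryPoints` lie on no quadric. -/
theorem eq_zero_of_frame_of_complementaryPoints [Field K] {a b : Fin 4 → K}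
    (h1 : a 0 * b 1 - a 1 * b 0 ≠ 0) (h2 : a 2 * b 3 - a 3 * b 2 ≠ 0)
    {g : (Fin 4 → K) → K} (hg : g ∈ quadraticFunctions K) (hf : ∀ i, g (frame a b i) = 0)
    (hc : ∀ l, g (complementaryPoints a b l) = 0) (x : Fin 4 → K) : g x = 0 := by
  obtain ⟨s, hs⟩ := hg
  have e0 := hf 0
  have e1 := hf 1
  have e2 := hf 2
  have e3 := hf 3
  have e4 := hf 4
  have e5 := hf 5
  have e6 := hc 0
  have e7 := hc 1
  have e8 := hc 2
  have e9 := hc 3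
  simp [frame, complementaryPoints, hs, dotProduct, mulVec, Fin.sum_univ_four, Pi.single_apply]
    at e0 e1 e2 e3 e4 e5 e6 e7 e8 e9
  simp only [e0, e1, e2, e3, zero_add, add_zero, zero_mul] at e4 e5 e6 e7 e8 e9
  set r02 := s 0 2 + s 2 0 with hr02
  set r03 := s 0 3 + s 3 0 with hr03
  set r12 := s 1 2 + s 2 1 with hr12
  set r13 := s 1 3 + s 3 1 with hr13
  have haa : a 0 * a 2 * r02 + a 0 * a 3 * r03 + a 1 * a 2 * r12 + a 1 * a 3 * r13 = 0 := by
    linear_combination e4 - a 0 * a 1 * e6 - a 2 * a 3 * e7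
  have hbb : b 0 * b 2 * r02 + b 0 * b 3 * r03 + b 1 * b 2 * r12 + b 1 * b 3 * r13 = 0 := by
    linear_combination e5 - b 0 * b 1 * e6 - b 2 * b 3 * e7
  have hab : a 0 * b 2 * r02 + a 0 * b 3 * r03 + a 1 * b 2 * r12 + a 1 * b 3 * r13 = 0 := by
    linear_combination e9 - a 0 * a 1 * e6 - b 2 * b 3 * e7
  have hba : b 0 * a 2 * r02 + b 0 * a 3 * r03 + b 1 * a 2 * r12 + b 1 * a 3 * r13 = 0 := by
    linear_combination e8 - haa - hbb - hab - (a 0 + b 0) * (a 1 + b 1) * e6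
      - (a 2 + b 2) * (a 3 + b 3) * e7
  have h12 := mul_ne_zero h1 h2
  have z02 : r02 = 0 := (mul_eq_zero_iff_right h12).mp (by
    linear_combination b 1 * b 3 * haa - b 1 * a 3 * hab - a 1 * b 3 * hba + a 1 * a 3 * hbb)
  have z03 : r03 = 0 := (mul_eq_zero_iff_right h12).mp (by
    linear_combination -b 1 * b 2 * haa + b 1 * a 2 * hab + a 1 * b 2 * hba - a 1 * a 2 * hbb)
  have z12 : r12 = 0 := (mul_eq_zero_iff_right h12).mp (by
    linear_combination -b 0 * b 3 * haa + b 0 * a 3 * hab + a 0 * b 3 * hba - a 0 * a 3 * hbb)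
  have z13 : r13 = 0 := (mul_eq_zero_iff_right h12).mp (by
    linear_combination b 0 * b 2 * haa - b 0 * a 2 * hab - a 0 * b 2 * hba + a 0 * a 2 * hbb)
  simp only [hs, dotProduct, mulVec, Fin.sum_univ_four]
  linear_combination x 0 ^ 2 * e0 + x 1 ^ 2 * e1 + x 2 ^ 2 * e2 + x 3 ^ 2 * e3
    + x 0 * x 1 * e6 + x 2 * x 3 * e7 + x 0 * x 2 * z02 + x 0 * x 3 * z03
    + x 1 * x 2 * z12 + x 1 * x 3 * z13

theorem det_reducibleQuadrics_complementaryPoints [CommRing K] (a b : Fin 4 → K) :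
    (Matrix.of fun l => reducibleQuadrics (frame a b) (complementaryPoints a b l)).det =
      -(bracketBinomial (frame a b) * (a 0 * b 1 - a 1 * b 0) ^ 2 *
        (a 2 * b 3 - a 3 * b 2) ^ 2) := by
  simp [Matrix.det_succ_row_zero, Fin.sum_univ_succ, Fin.succAbove, reducibleQuadrics,
    complementaryPoints, frame, bracketBinomial, br_eq]
  ring

theorem exists_homogeneous_of_mem_quadraticFunctions [CommRing K] {g : (Fin 4 → K) → K}
    (hg : g ∈ quadraticFunctions K) :
    ∃ f : MvPolynomial (Fin 4) K, f.IsHomogeneous 2 ∧ ∀ x, MvPolynomial.eval x f = g x := by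
  obtain ⟨s, hs⟩ := hg
  refine ⟨∑ i, ∑ j, MvPolynomial.C (s i j) * (MvPolynomial.X i * MvPolynomial.X j), ?_, ?_⟩
  · refine MvPolynomial.IsHomogeneous.sum _ _ _ fun i _ =>
      MvPolynomial.IsHomogeneous.sum _ _ _ fun j _ => ?_
    exact ((MvPolynomial.isHomogeneous_X K i).mul (MvPolynomial.isHomogeneous_X K j)).C_mul _
  · intro x
    simp only [hs, map_sum, map_mul, MvPolynomial.eval_C, MvPolynomial.eval_X, dotProduct,
      mulVec, Finset.mul_sum]
    exact Finset.sum_congr rfl fun i _ => Finset.sum_congr rfl fun j _ => by ring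

/-- Six points, the first four of which are independent, are a linear image of a frame. -/
theorem exists_eq_frame_vecMul [Field K] (p : Fin 6 → Fin 4 → K)
    (h : br (p 0) (p 1) (p 2) (p 3) ≠ 0) :
    ∃ (P : Matrix (Fin 4) (Fin 4) K) (a b : Fin 4 → K), P.det ≠ 0 ∧
      p = fun i => frame a b i ᵥ* P := by
  refine ⟨Matrix.of ![p 0, p 1, p 2, p 3], p 4 ᵥ* (Matrix.of ![p 0, p 1, p 2, p 3])⁻¹,
    p 5 ᵥ* (Matrix.of ![p 0, p 1, p 2, p 3])⁻¹, h, ?_⟩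
  have hinv := Matrix.nonsing_inv_mul (Matrix.of ![p 0, p 1, p 2, p 3]) (isUnit_iff_ne_zero.mpr h)
  funext i
  fin_cases i
  · exact (single_one_vecMul (0 : Fin 4) (Matrix.of ![p 0, p 1, p 2, p 3])).symm
  · exact (single_one_vecMul (1 : Fin 4) (Matrix.of ![p 0, p 1, p 2, p 3])).symm
  · exact (single_one_vecMul (2 : Fin 4) (Matrix.of ![p 0, p 1, p 2, p 3])).symm
  · exact (single_one_vecMul (3 : Fin 4) (Matrix.of ![p 0, p 1, p 2, p 3])).symm
  · simp [frame, hinv]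
  · simp [frame, hinv]

theorem frame_skew_conditions [CommRing K] (a b : Fin 4 → K) :
    br (frame a b 0) (frame a b 1) (frame a b 4) (frame a b 5) = a 2 * b 3 - a 3 * b 2 ∧
      br (frame a b 2) (frame a b 3) (frame a b 4) (frame a b 5) = a 0 * b 1 - a 1 * b 0 := by
  constructor <;> simp [frame, br_eq]

section SkewLines

variable [Field K] {p : Fin 6 → Fin 4 → K}

theorem eq_zero_of_reducibleQuadrics_dotProduct_eq_zero
    (h0123 : br (p 0) (p 1) (p 2) (p 3) ≠ 0) (h0145 : br (p 0) (p 1) (p 4) (p 5) ≠ 0)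
    (h2345 : br (p 2) (p 3) (p 4) (p 5) ≠ 0) (hQ : bracketBinomial p ≠ 0) {w : Fin 4 → K}
    (hw : ∀ x, reducibleQuadrics p x ⬝ᵥ w = 0) : w = 0 := by
  obtain ⟨P, a, b, hP, rfl⟩ := exists_eq_frame_vecMul p h0123
  rw [br_vecMul, (frame_skew_conditions a b).1] at h0145
  rw [br_vecMul, (frame_skew_conditions a b).2] at h2345
  rw [bracketBinomial_vecMul] at hQ
  have hdet : (Matrix.of fun l =>
      reducibleQuadrics (frame a b) (complementaryPoints a b l)).det ≠ 0 := by
    rw [det_reducibleQuadrics_complementaryPoints]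
    exact neg_ne_zero.mpr (mul_ne_zero (mul_ne_zero (right_ne_zero_of_mul hQ)
      (pow_ne_zero 2 (left_ne_zero_of_mul h2345))) (pow_ne_zero 2 (left_ne_zero_of_mul h0145)))
  refine eq_zero_of_mulVec_eq_zero hdet (funext fun l => ?_)
  have h := hw (complementaryPoints a b l ᵥ* P)
  rw [reducibleQuadrics_vecMul, smul_dotProduct, smul_eq_mul] at h
  exact (mul_eq_zero_iff_left (pow_ne_zero 2 hP)).mp h

theorem exists_eq_reducibleQuadrics_dotProduct
    (h0123 : br (p 0) (p 1) (p 2) (p 3) ≠ 0) (h0145 : br (p 0) (p 1) (p 4) (p 5) ≠ 0)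
    (h2345 : br (p 2) (p 3) (p 4) (p 5) ≠ 0) (hQ : bracketBinomial p ≠ 0)
    {g : (Fin 4 → K) → K} (hg : g ∈ quadraticFunctions K) (hp : ∀ i, g (p i) = 0) :
    ∃ w, ∀ x, g x = reducibleQuadrics p x ⬝ᵥ w := by
  obtain ⟨P, a, b, hP, rfl⟩ := exists_eq_frame_vecMul p h0123
  rw [br_vecMul, (frame_skew_conditions a b).1] at h0145
  rw [br_vecMul, (frame_skew_conditions a b).2] at h2345
  rw [bracketBinomial_vecMul] at hQ
  set G : Matrix (Fin 4) (Fin 4) K :=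
    Matrix.of fun l => reducibleQuadrics (frame a b) (complementaryPoints a b l) with hG
  have hdet : IsUnit G.det := by
    rw [hG, det_reducibleQuadrics_complementaryPoints, isUnit_iff_ne_zero]
    exact neg_ne_zero.mpr (mul_ne_zero (mul_ne_zero (right_ne_zero_of_mul hQ)
      (pow_ne_zero 2 (left_ne_zero_of_mul h2345))) (pow_ne_zero 2 (left_ne_zero_of_mul h0145)))
  set w := G⁻¹ *ᵥ fun l => g (complementaryPoints a b l ᵥ* P)
  have hGw : G *ᵥ w = fun l => g (complementaryPoints a b l ᵥ* P) := by
    rw [mulVec_mulVec, Matrix.mul_nonsing_inv G hdet, one_mulVec]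
  have hdiff := eq_zero_of_frame_of_complementaryPoints (left_ne_zero_of_mul h2345)
    (left_ne_zero_of_mul h0145)
    (Submodule.sub_mem _ (comp_vecMul_mem_quadraticFunctions hg P)
      (sum_reducibleQuadrics_mem_quadraticFunctions (frame a b) w))
    (fun i => by simp [hp, reducibleQuadrics_self])
    (fun l => sub_eq_zero.mpr (congrFun hGw l).symm)
  refine ⟨(P.det ^ 2)⁻¹ • w, fun x => ?_⟩
  obtain ⟨y, rfl⟩ : ∃ y, y ᵥ* P = x :=
    ⟨x ᵥ* P⁻¹, by rw [vecMul_vecMul, Matrix.nonsing_inv_mul P (isUnit_iff_ne_zero.mpr hP),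
      vecMul_one]⟩
  rw [reducibleQuadrics_vecMul, smul_dotProduct, dotProduct_smul, smul_smul,
    mul_inv_cancel₀ (pow_ne_zero 2 hP), one_smul]
  exact sub_eq_zero.mp (hdiff y)

end SkewLines

end ReducibleQuadrics

/-- Main theorem of the generic case (Section 3): when the lines `01`, `23`,
`45` are mutually skew and the bracket binomial `Q` is nonzero, the ten points
lie on a quadric surface iff the 4×4 matrix `M` of evaluations of the basis
`𝒮` of reducible quadrics at the points `6`, `7`, `8`, `9` is singular. -/
theorem ten_points_on_quadric_iff_det_M_eq_zero {K : Type*} [Field K]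
    [CharZero K] (v : Fin 10 → Fin 4 → K) (hv : ∀ i, v i ≠ 0)
    (h0123 : br (v 0) (v 1) (v 2) (v 3) ≠ 0)
    (h0145 : br (v 0) (v 1) (v 4) (v 5) ≠ 0)
    (h2345 : br (v 2) (v 3) (v 4) (v 5) ≠ 0)
    (hQ : br (v 0) (v 1) (v 2) (v 5) * br (v 0) (v 2) (v 3) (v 4) *
          br (v 1) (v 3) (v 4) (v 5) -
        br (v 0) (v 1) (v 2) (v 4) * br (v 2) (v 3) (v 4) (v 5) *
          br (v 0) (v 1) (v 3) (v 5) ≠ 0) :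
    (∃ f : MvPolynomial (Fin 4) K, f ≠ 0 ∧ f.IsHomogeneous 2 ∧
        ∀ i, MvPolynomial.eval (v i) f = 0) ↔
      (Matrix.of fun k : Fin 4 =>
        ![br (v 0) (v 1) (v 5) (v ⟨(k : ℕ) + 6, by omega⟩) *
            br (v 2) (v 3) (v 4) (v ⟨(k : ℕ) + 6, by omega⟩),
          br (v 0) (v 1) (v 2) (v ⟨(k : ℕ) + 6, by omega⟩) *
            br (v 3) (v 4) (v 5) (v ⟨(k : ℕ) + 6, by omega⟩),
          br (v 0) (v 2) (v 4) (v ⟨(k : ℕ) + 6, by omega⟩) *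
            br (v 1) (v 3) (v 5) (v ⟨(k : ℕ) + 6, by omega⟩),
          br (v 0) (v 4) (v 5) (v ⟨(k : ℕ) + 6, by omega⟩) *
            br (v 1) (v 2) (v 3) (v ⟨(k : ℕ) + 6, by omega⟩)]).det = 0 := by
  set p : Fin 6 → Fin 4 → K := fun i => v (Fin.castLE (by omega) i)
  set M : Matrix (Fin 4) (Fin 4) K :=
    Matrix.of fun k => reducibleQuadrics p (v ⟨(k : ℕ) + 6, by omega⟩)
  change _ ↔ M.det = 0
  rw [← Matrix.exists_mulVec_eq_zero_iff]
  constructor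
  · rintro ⟨f, hf0, hf, hfv⟩
    obtain ⟨w, hw⟩ := exists_eq_reducibleQuadrics_dotProduct (p := p) h0123 h0145 h2345 hQ
      hf.eval_mem_quadraticFunctions (fun i => hfv _)
    refine ⟨w, ?_, funext fun k => (hw _).symm.trans (hfv _)⟩
    rintro rfl
    exact hf0 (MvPolynomial.funext fun x => by simpa using hw x)
  · rintro ⟨w, hw0, hw⟩
    obtain ⟨f, hf, hfw⟩ := exists_homogeneous_of_mem_quadraticFunctions
      (sum_reducibleQuadrics_mem_quadraticFunctions p w)
    refine ⟨f, ?_, hf, fun i => ?_⟩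
    · rintro rfl
      exact hw0 (eq_zero_of_reducibleQuadrics_dotProduct_eq_zero (p := p) h0123 h0145 h2345 hQ
        fun x => by rw [← hfw x, map_zero])
    · rw [hfw]
      rcases lt_or_ge (i : ℕ) 6 with hi | hi
      · have hpi : v i = p ⟨i, hi⟩ := rfl
        rw [hpi, reducibleQuadrics_self, zero_dotProduct]
      · obtain ⟨k, hk⟩ : ∃ k : Fin 4, i = ⟨(k : ℕ) + 6, by omega⟩ :=
          ⟨⟨i - 6, by omega⟩, Fin.ext (by simp; omega)⟩
        rw [hk]
        exact congrFun hw k
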